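/- Consider the retarded ODE system dZ/dt = a(Z_t) + (1/h(t)) ∫_{t−h(t)}^t Kμ_σ(Z_t) dσ with h(t) = t, where a is globally Lipschitz, B (defining K) is bounded and Lipschitz in each variable, and μ_t is the push-forward of μ₀ under the flow. Then the associated integral-equation fixed-point map T on C([0,T]×ℝᵐ; ℝᵐ) has a unique fixed point, i.e., the mean-field equation admits a unique global solution Z ∈ C(ℝ₊×ℝᵐ; ℝᵐ). -/

import Mathlib

open MeasureTheory

set_option linter.unusedSectionVars false

section MF
variable {E : Type*} [NormedAddCommGroup E] [NormedSpace ℝ E] [CompleteSpace E]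
  [MeasurableSpace E] [BorelSpace E] [SecondCountableTopology E]

noncomputable def mfAvg (B : E → E → E) (μ : Measure E) (V : ℝ → E → E) (s : ℝ) (z : E) : E :=
  ∫ u in (0:ℝ)..1, ∫ w, B (V s z) (V (s * u) w) ∂μ

noncomputable def mfF (a : E → E) (B : E → E → E) (μ : Measure E) (V : ℝ → E → E)
    (s : ℝ) (z : E) : E := a (V s z) + mfAvg B μ V s z

lemma mf_inner_cont (B : E → E → E) (hB : Continuous (Function.uncurry B)) (C : ℝ)
    (hC : ∀ z w, ‖B z w‖ ≤ C) (μ : Measure E) [IsProbabilityMeasure μ]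
    (V : ℝ → E → E) (hV : Continuous (Function.uncurry V)) :
    Continuous (fun p : (ℝ × E) × ℝ => ∫ w, B (V p.1.1 p.1.2) (V (p.1.1 * p.2) w) ∂μ) := by
  have hc : Continuous (fun q : ((ℝ × E) × ℝ) × E =>
      B (V q.1.1.1 q.1.1.2) (V (q.1.1.1 * q.1.2) q.2)) := by
    refine hB.comp (Continuous.prodMk ?_ ?_)
    · exact hV.comp (by fun_prop : Continuous fun q : ((ℝ × E) × ℝ) × E => (q.1.1.1, q.1.1.2))
    · exact hV.comp (by fun_prop : Continuous fun q : ((ℝ × E) × ℝ) × E => (q.1.1.1 * q.1.2, q.2))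
  refine continuous_of_dominated (bound := fun _ => C) ?_ ?_ (integrable_const _) ?_
  · intro p
    exact (hc.comp (by fun_prop : Continuous fun w : E => (p, w))).aestronglyMeasurable
  · intro p; exact Filter.Eventually.of_forall fun w => hC _ _
  · refine Filter.Eventually.of_forall fun w => ?_
    exact hc.comp (by fun_prop : Continuous fun p : (ℝ × E) × ℝ => (p, w))

lemma mfAvg_cont (B : E → E → E) (hB : Continuous (Function.uncurry B)) (C : ℝ)
    (hC : ∀ z w, ‖B z w‖ ≤ C) (μ : Measure E) [IsProbabilityMeasure μ]
    (V : ℝ → E → E) (hV : Continuous (Function.uncurry V)) :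
    Continuous (fun p : ℝ × E => mfAvg B μ V p.1 p.2) := by
  have h := mf_inner_cont B hB C hC μ V hV
  exact intervalIntegral.continuous_parametric_intervalIntegral_of_continuous'
    (f := fun (p : ℝ × E) (u : ℝ) => ∫ w, B (V p.1 p.2) (V (p.1 * u) w) ∂μ) h 0 1

lemma mfAvg_norm_le (B : E → E → E) (C : ℝ)
    (hC : ∀ z w, ‖B z w‖ ≤ C) (μ : Measure E) [IsProbabilityMeasure μ]
    (V : ℝ → E → E) (s : ℝ) (z : E) : ‖mfAvg B μ V s z‖ ≤ C := by
  unfold mfAvg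
  refine (intervalIntegral.norm_integral_le_of_norm_le_const (C := C) ?_).trans (by simp)
  intro u _
  refine (norm_integral_le_of_norm_le_const (Filter.Eventually.of_forall fun w => hC _ _)).trans
    (by simp)

lemma mfF_cont (a : E → E) (ha : Continuous a) (B : E → E → E)
    (hB : Continuous (Function.uncurry B)) (C : ℝ)
    (hC : ∀ z w, ‖B z w‖ ≤ C) (μ : Measure E) [IsProbabilityMeasure μ]
    (V : ℝ → E → E) (hV : Continuous (Function.uncurry V)) :
    Continuous (Function.uncurry (mfF a B μ V)) :=
  (ha.comp hV).add (mfAvg_cont B hB C hC μ V hV)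

lemma mf_exp_int (l t D : ℝ) (hl : 0 < l) (hD : 0 ≤ D) (f : ℝ → E)
    (ht : 0 ≤ t) (h : ∀ s, 0 ≤ s → s ≤ t → ‖f s‖ ≤ D * Real.exp (l * s)) :
    ‖∫ s in (0:ℝ)..t, f s‖ ≤ D / l * Real.exp (l * t) := by
  have h1 : ∫ s in (0:ℝ)..t, D * Real.exp (l * s) = D / l * (Real.exp (l * t) - 1) := by
    have : ∀ s ∈ Set.uIcc 0 t,
        HasDerivAt (fun s => D / l * Real.exp (l * s)) (D * Real.exp (l * s)) s := by
      intro s _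
      have := (((hasDerivAt_id' s).const_mul l).exp).const_mul (D / l)
      have e : D * Real.exp (l * s) = D / l * (Real.exp (l * s) * (l * 1)) := by
        field_simp
      rw [e]
      exact this
    rw [intervalIntegral.integral_eq_sub_of_hasDerivAt this
      (Continuous.intervalIntegrable (by fun_prop) _ _)]
    simp; ring
  have h2 := intervalIntegral.norm_integral_le_of_norm_le (μ := volume) (f := f) ht
    (g := fun s => D * Real.exp (l * s))
    (Filter.Eventually.of_forall fun s hs => h s hs.1.le hs.2)
    (Continuous.intervalIntegrable (by fun_prop) _ _)
  rw [h1] at h2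
  have : 0 ≤ D / l := by positivity
  nlinarith

/-- the frozen right-hand side -/
lemma mf_rhs (a : E → E) (ha : Continuous a) (B : E → E → E)
    (hB : Continuous (Function.uncurry B)) (C : ℝ)
    (hC : ∀ z w, ‖B z w‖ ≤ C) (μ : Measure E) [IsProbabilityMeasure μ]
    (V : ℝ → E → E) (hV : Continuous (Function.uncurry V)) (Z : ℝ → E → E)
    (hZ : ∀ t, 0 ≤ t → ∀ z, Z t z = V t z) (z : E) (t : ℝ) (ht : 0 ≤ t) :
    z + (∫ s in (0:ℝ)..t, a (Z s z)) +
          (∫ s in (0:ℝ)..t, (1 / s) • ∫ σ in (0:ℝ)..s, ∫ w, B (Z s z) (Z σ w) ∂μ)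
      = z + ∫ s in (0:ℝ)..t, mfF a B μ V s z := by
  have e1 : (∫ s in (0:ℝ)..t, a (Z s z)) = ∫ s in (0:ℝ)..t, a (V s z) := by
    refine intervalIntegral.integral_congr fun s hs => ?_
    rw [Set.uIcc_of_le ht] at hs
    simp only [hZ s hs.1]
  have e2 : (∫ s in (0:ℝ)..t, (1 / s) • ∫ σ in (0:ℝ)..s, ∫ w, B (Z s z) (Z σ w) ∂μ)
      = ∫ s in (0:ℝ)..t, mfAvg B μ V s z := by
    refine intervalIntegral.integral_congr_ae (Filter.Eventually.of_forall fun s hs => ?_)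
    rw [Set.uIoc_of_le ht] at hs
    have hs0 : s ≠ 0 := hs.1.ne'
    unfold mfAvg
    have := intervalIntegral.smul_integral_comp_mul_left (a := 0) (b := 1)
      (fun σ => ∫ w, B (V s z) (V σ w) ∂μ) s
    simp only [mul_zero, mul_one] at this
    have e3 : (∫ σ in (0:ℝ)..s, ∫ w, B (Z s z) (Z σ w) ∂μ)
       = ∫ σ in (0:ℝ)..s, ∫ w, B (V s z) (V σ w) ∂μ := by
      refine intervalIntegral.integral_congr fun σ hσ => ?_
      rw [Set.uIcc_of_le hs.1.le] at hσ
      simp only [hZ s hs.1.le, hZ σ hσ.1]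
    rw [e3, ← this, smul_smul, one_div, inv_mul_cancel₀ hs0, one_smul]
  have hVs : Continuous fun s => V s z := hV.comp (by fun_prop : Continuous fun s : ℝ => (s, z))
  have hAs : Continuous fun s => mfAvg B μ V s z :=
    (mfAvg_cont B hB C hC μ V hV).comp (by fun_prop : Continuous fun s : ℝ => (s, z))
  rw [e1, e2, add_assoc]
  congr 1
  unfold mfF
  rw [intervalIntegral.integral_add]
  · exact (ha.comp hVs).intervalIntegrable _ _
  · exact hAs.intervalIntegrable _ _

lemma mfF_lip (a : E → E) (La Lb : ℝ) (hLa : 0 ≤ La) (hLb : 0 ≤ Lb)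
    (ha : ∀ x y, ‖a x - a y‖ ≤ La * ‖x - y‖) (B : E → E → E)
    (hB : Continuous (Function.uncurry B)) (C : ℝ)
    (hC : ∀ z w, ‖B z w‖ ≤ C) 
    (h1 : ∀ z₁ z₂ w, ‖B z₁ w - B z₂ w‖ ≤ Lb * min 1 ‖z₁ - z₂‖)
    (h2 : ∀ z w₁ w₂, ‖B z w₁ - B z w₂‖ ≤ Lb * min 1 ‖w₁ - w₂‖)
    (μ : Measure E) [IsProbabilityMeasure μ] (hμ : Integrable (fun z => ‖z‖) μ)
    (V V' : ℝ → E → E) (hV : Continuous (Function.uncurry V))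
    (hV' : Continuous (Function.uncurry V')) (l D : ℝ) (hl : 0 ≤ l) (hD : 0 ≤ D)
    (h : ∀ s, 0 ≤ s → ∀ z, ‖V s z - V' s z‖ ≤ D * Real.exp (l * s) * (1 + ‖z‖))
    (s : ℝ) (hs : 0 ≤ s) (z : E) :
    ‖mfF a B μ V s z - mfF a B μ V' s z‖ ≤
      (La + Lb * (2 + ∫ w, ‖w‖ ∂μ)) * (D * (1 + ‖z‖)) * Real.exp (l * s) := by
  set M := ∫ w, ‖w‖ ∂μ with hM
  have hM0 : 0 ≤ M := integral_nonneg fun _ => norm_nonneg _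
  have hci : ∀ W : ℝ → E → E, Continuous (Function.uncurry W) → ∀ u : ℝ,
      Integrable (fun w => B (W s z) (W (s * u) w)) μ := by
    intro W hW u
    refine Integrable.mono' (integrable_const C) ?_ (Filter.Eventually.of_forall fun w => hC _ _)
    have : Continuous fun w => W (s * u) w := hW.comp (by fun_prop : Continuous fun w : E => (s * u, w))
    exact (hB.comp (by fun_prop : Continuous fun w => (W s z, W (s * u) w))).aestronglyMeasurable
  have hcu : ∀ W : ℝ → E → E, Continuous (Function.uncurry W) →
      IntervalIntegrable (fun u => ∫ w, B (W s z) (W (s * u) w) ∂μ) volume 0 1 := by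
    intro W hW
    exact ((mf_inner_cont B hB C hC μ W hW).comp
      (by fun_prop : Continuous fun u : ℝ => ((s, z), u))).intervalIntegrable _ _
  have hin : ‖mfAvg B μ V s z - mfAvg B μ V' s z‖ ≤
      Lb * (D * Real.exp (l * s) * (2 + ‖z‖ + M)) := by
    unfold mfAvg
    rw [← intervalIntegral.integral_sub (hcu V hV) (hcu V' hV')]
    refine (intervalIntegral.norm_integral_le_of_norm_le_const
      (C := Lb * (D * Real.exp (l * s) * (2 + ‖z‖ + M))) ?_).trans (by simp)
    intro u hu
    rw [Set.uIoc_of_le zero_le_one] at hu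
    rw [← integral_sub (hci V hV u) (hci V' hV' u)]
    have hb : ∀ w, ‖B (V s z) (V (s * u) w) - B (V' s z) (V' (s * u) w)‖ ≤
        Lb * (D * Real.exp (l * s) * (2 + ‖z‖ + ‖w‖)) := by
      intro w
      have k1 := (h1 (V s z) (V' s z) (V (s * u) w)).trans
        (mul_le_mul_of_nonneg_left ((min_le_right _ _).trans (h s hs z)) hLb)
      have k2 := (h2 (V' s z) (V (s * u) w) (V' (s * u) w)).trans
        (mul_le_mul_of_nonneg_left ((min_le_right _ _).trans
          (h (s * u) (mul_nonneg hs hu.1.le) w)) hLb)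
      have k3 : Real.exp (l * (s * u)) ≤ Real.exp (l * s) := by
        apply Real.exp_le_exp.2
        exact mul_le_mul_of_nonneg_left (mul_le_of_le_one_right hs hu.2) hl
      have k4 : Lb * (D * Real.exp (l * (s * u)) * (1 + ‖w‖)) ≤
          Lb * (D * Real.exp (l * s) * (1 + ‖w‖)) := by gcongr
      have k5 := norm_add_le (B (V s z) (V (s * u) w) - B (V' s z) (V (s * u) w))
        (B (V' s z) (V (s * u) w) - B (V' s z) (V' (s * u) w))
      rw [sub_add_sub_cancel] at k5
      linarith
    have hint : Integrable (fun w : E => Lb * (D * Real.exp (l * s) * (2 + ‖z‖ + ‖w‖))) μ :=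
      (((integrable_const _).add hμ).const_mul _).const_mul _
    refine (norm_integral_le_of_norm_le hint (Filter.Eventually.of_forall hb)).trans (le_of_eq ?_)
    rw [integral_const_mul, integral_const_mul, integral_add (integrable_const _) hμ]
    simp [hM]
  have hout := (ha (V s z) (V' s z)).trans (mul_le_mul_of_nonneg_left (h s hs z) hLa)
  have : mfF a B μ V s z - mfF a B μ V' s z =
    (a (V s z) - a (V' s z)) + (mfAvg B μ V s z - mfAvg B μ V' s z) := by
    unfold mfF; abel
  rw [this]
  refine (norm_add_le _ _).trans ((add_le_add hout hin).trans ?_)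
  have : 0 ≤ Lb * (D * Real.exp (l * s)) * ((1 + M) * ‖z‖) := by positivity
  nlinarith

/-- A priori bound. -/
lemma mf_apriori (a : E → E) (La : ℝ) (hLa : 0 ≤ La)
    (ha : ∀ x y, ‖a x - a y‖ ≤ La * ‖x - y‖) (B : E → E → E) (C : ℝ) (hC0 : 0 ≤ C)
    (hC : ∀ z w, ‖B z w‖ ≤ C) (μ : Measure E) [IsProbabilityMeasure μ]
    (V : ℝ → E → E) (hV : Continuous (Function.uncurry V)) (l : ℝ) (hl : 1 ≤ l)
    (hl2 : 2 * La ≤ l)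
    (h : ∀ t, 0 ≤ t → ∀ z, V t z = z + ∫ s in (0:ℝ)..t, mfF a B μ V s z)
    (t : ℝ) (ht : 0 ≤ t) (z : E) :
    ‖V t z‖ ≤ 2 * (‖z‖ + ‖a 0‖ + C) * Real.exp (l * t) := by
  have hVs : Continuous fun s => V s z := hV.comp (by fun_prop : Continuous fun s : ℝ => (s, z))
  obtain ⟨r, hr, hmax⟩ := (isCompact_Icc (a := (0:ℝ)) (b := t)).exists_isMaxOn
    ⟨0, le_refl _, ht⟩
    (f := fun s => Real.exp (-(l * s)) * ‖V s z‖) (by fun_prop)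
  set S := Real.exp (-(l * r)) * ‖V r z‖ with hS
  have hS0 : 0 ≤ S := by positivity
  have hb : ∀ s, 0 ≤ s → s ≤ t → ‖V s z‖ ≤ S * Real.exp (l * s) := by
    intro s h0 h1
    have := hmax (show s ∈ Set.Icc 0 t from ⟨h0, h1⟩)
    simp only [Set.mem_ofPred_eq] at this
    have k := mul_le_mul_of_nonneg_right this (Real.exp_pos (l * s)).le
    rw [mul_right_comm, ← Real.exp_add] at k
    simpa using k
  have hF : ∀ s, 0 ≤ s → s ≤ r →
      ‖mfF a B μ V s z‖ ≤ (‖a 0‖ + C + La * S) * Real.exp (l * s) := by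
    intro s h0 h1
    have k1 := norm_add_le (a (V s z)) (mfAvg B μ V s z)
    have k2 := mfAvg_norm_le B C hC μ V s z
    have k3 : ‖a (V s z)‖ ≤ ‖a 0‖ + La * ‖V s z‖ := by
      have := norm_add_le (a 0) (a (V s z) - a 0)
      have k := ha (V s z) 0
      rw [add_sub_cancel] at this
      rw [sub_zero] at k
      linarith
    have k4 := mul_le_mul_of_nonneg_left (hb s h0 (h1.trans hr.2)) hLa
    have k5 : 1 ≤ Real.exp (l * s) := Real.one_le_exp (by positivity)
    unfold mfF
    have : 0 ≤ ‖a 0‖ := norm_nonneg _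
    nlinarith
  have hI := mf_exp_int l r (‖a 0‖ + C + La * S) (by linarith) (by positivity)
    (fun s => mfF a B μ V s z) hr.1 hF
  have hVr := norm_add_le z (∫ s in (0:ℝ)..r, mfF a B μ V s z)
  rw [← h r hr.1 z] at hVr
  have hq : (‖a 0‖ + C + La * S) / l ≤ ‖a 0‖ + C + S / 2 := by
    rw [div_le_iff₀ (by linarith)]
    have : 0 ≤ ‖a 0‖ + C := by positivity
    nlinarith
  have h5 : 1 ≤ Real.exp (l * r) := Real.one_le_exp (mul_nonneg (by linarith) hr.1)
  have hSle : S ≤ ‖z‖ + ‖a 0‖ + C + S / 2 := by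
    have e : Real.exp (-(l * r)) * Real.exp (l * r) = 1 := by rw [← Real.exp_add]; simp
    have k : ‖V r z‖ ≤ (‖z‖ + ‖a 0‖ + C + S / 2) * Real.exp (l * r) := by
      have : 0 ≤ ‖z‖ := norm_nonneg _
      nlinarith [mul_le_mul_of_nonneg_right hq (Real.exp_pos (l * r)).le]
    calc S ≤ Real.exp (-(l * r)) * ((‖z‖ + ‖a 0‖ + C + S / 2) * Real.exp (l * r)) := by
          rw [hS]; exact mul_le_mul_of_nonneg_left k (Real.exp_pos _).le
      _ = (‖z‖ + ‖a 0‖ + C + S / 2) * (Real.exp (-(l * r)) * Real.exp (l * r)) := by ring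
      _ = _ := by rw [e, mul_one]
  refine (hb t ht le_rfl).trans ?_
  gcongr
  linarith

/-- Global contraction in a weighted space of bounded continuous functions. -/
lemma mf_main (a : E → E) (La Lb : ℝ) (hLa : 0 ≤ La) (hLb : 0 ≤ Lb)
    (ha : ∀ x y, ‖a x - a y‖ ≤ La * ‖x - y‖) (B : E → E → E)
    (hB : Continuous (Function.uncurry B)) (C : ℝ)
    (hC : ∀ z w, ‖B z w‖ ≤ C)
    (h1 : ∀ z₁ z₂ w, ‖B z₁ w - B z₂ w‖ ≤ Lb * min 1 ‖z₁ - z₂‖)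
    (h2 : ∀ z w₁ w₂, ‖B z w₁ - B z w₂‖ ≤ Lb * min 1 ‖w₁ - w₂‖)
    (μ : Measure E) [IsProbabilityMeasure μ] (hμ : Integrable (fun z => ‖z‖) μ) :
    ∃ V : ℝ → E → E, Continuous (Function.uncurry V) ∧
      (∀ t, 0 ≤ t → ∀ z, V t z = z + ∫ s in (0:ℝ)..t, mfF a B μ V s z) ∧
      ∀ V' : ℝ → E → E, Continuous (Function.uncurry V') →
        (∀ t z, V' t z = V' (max t 0) z) →
        (∀ t, 0 ≤ t → ∀ z, V' t z = z + ∫ s in (0:ℝ)..t, mfF a B μ V' s z) →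
        ∀ t, 0 ≤ t → ∀ z, V' t z = V t z := by
  have hac : Continuous a := by
    have : LipschitzWith La.toNNReal a := LipschitzWith.of_dist_le_mul fun x y => by
      rw [dist_eq_norm, dist_eq_norm, Real.coe_toNNReal _ hLa]; exact ha x y
    exact this.continuous
  have hC0 : 0 ≤ C := (norm_nonneg _).trans (hC 0 0)
  have hM0 : 0 ≤ ∫ w, ‖w‖ ∂μ := integral_nonneg fun _ => norm_nonneg _
  obtain ⟨K, hK⟩ : ∃ K, K = La + Lb * (2 + ∫ w, ‖w‖ ∂μ) := ⟨_, rfl⟩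
  have hKLa : La ≤ K := by
    have : 0 ≤ Lb * (2 + ∫ w, ‖w‖ ∂μ) := by positivity
    linarith
  have hK0 : 0 ≤ K := hLa.trans hKLa
  obtain ⟨l, hl⟩ : ∃ l, l = 2 * K + 2 := ⟨_, rfl⟩
  have hl0 : 0 < l := by linarith
  let wt : ℝ × E → ℝ := fun p => Real.exp (l * max p.1 0) * (1 + ‖p.2‖)
  have hwt : ∀ p, 0 < wt p := fun p => by
    have : 0 ≤ ‖p.2‖ := norm_nonneg _
    exact mul_pos (Real.exp_pos _) (by linarith)
  have hwtc : Continuous wt := by fun_prop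
  have hwtv : ∀ t z, 0 ≤ t → wt (t, z) = Real.exp (l * t) * (1 + ‖z‖) := by
    intro t z ht; simp [wt, max_eq_left ht]
  let X := BoundedContinuousFunction (ℝ × E) E
  let Vof : X → ℝ → E → E := fun u t z => z + wt (t, z) • u (t, z)
  have hVc : ∀ u, Continuous (Function.uncurry (Vof u)) := by
    intro u
    exact continuous_snd.add (hwtc.smul u.continuous)
  -- estimate of the integral for an arbitrary bounded remainder
  have hFcont : ∀ V : ℝ → E → E, Continuous (Function.uncurry V) → Continuous
      (fun p : ℝ × E => (wt p)⁻¹ • ∫ s in (0:ℝ)..max p.1 0, mfF a B μ V s p.2) := by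
    intro V hV
    have hF := mfF_cont a hac B hB C hC μ V hV
    refine (hwtc.inv₀ fun p => (hwt p).ne').smul ?_
    refine intervalIntegral.continuous_parametric_intervalIntegral_of_continuous
      (f := fun (p : ℝ × E) s => mfF a B μ V s p.2) ?_ (by fun_prop)
    exact hF.comp (by fun_prop : Continuous fun q : (ℝ × E) × ℝ => (q.2, q.1.2))
  have hex : ∀ u : X, ∃ v : X, ∀ p, v p =
      (wt p)⁻¹ • ∫ s in (0:ℝ)..max p.1 0, mfF a B μ (Vof u) s p.2 := by
    intro u
    refine ⟨BoundedContinuousFunction.ofNormedAddCommGroup _ (hFcont _ (hVc u))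
      ((‖a 0‖ + C + La * (1 + ‖u‖)) / l) ?_, fun p => rfl⟩
    rintro ⟨t, z⟩
    have hz : 0 ≤ ‖z‖ := norm_nonneg _
    have hb := mf_exp_int l (max t 0) ((‖a 0‖ + C + La * (1 + ‖u‖)) * (1 + ‖z‖)) hl0
      (by positivity) (fun s => mfF a B μ (Vof u) s z) (le_max_right _ _) (by
        intro s hs _
        have k1 := norm_add_le (a (Vof u s z)) (mfAvg B μ (Vof u) s z)
        have k2 := mfAvg_norm_le B C hC μ (Vof u) s z
        have k3 : ‖a (Vof u s z)‖ ≤ ‖a 0‖ + La * ‖Vof u s z‖ := by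
          have := norm_add_le (a 0) (a (Vof u s z) - a 0)
          have k := ha (Vof u s z) 0
          rw [add_sub_cancel] at this
          rw [sub_zero] at k
          linarith
        have k5 : 1 ≤ Real.exp (l * s) := Real.one_le_exp (by positivity)
        have k4 : ‖Vof u s z‖ ≤ (1 + ‖u‖) * (1 + ‖z‖) * Real.exp (l * s) := by
          have : ‖Vof u s z‖ ≤ ‖z‖ + ‖wt (s, z) • u (s, z)‖ := norm_add_le _ _
          rw [norm_smul, Real.norm_of_nonneg (hwt _).le, hwtv s z hs] at this
          have h6 : Real.exp (l * s) * (1 + ‖z‖) * ‖u (s, z)‖ ≤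
            Real.exp (l * s) * (1 + ‖z‖) * ‖u‖ := by
            gcongr; exact u.norm_coe_le_norm _
          have h7 : ‖z‖ ≤ (1 + ‖z‖) * Real.exp (l * s) := by nlinarith
          calc _ ≤ _ := this
            _ ≤ (1 + ‖z‖) * Real.exp (l * s) + Real.exp (l * s) * (1 + ‖z‖) * ‖u‖ :=
              add_le_add h7 h6
            _ = _ := by ring
        have k6 := mul_le_mul_of_nonneg_left k4 hLa
        have k7 : 1 ≤ (1 + ‖z‖) * Real.exp (l * s) := by nlinarith
        have k8 := mul_le_mul_of_nonneg_left k7 (by positivity : 0 ≤ ‖a 0‖ + C)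
        unfold mfF
        nlinarith)
    rw [norm_smul, norm_inv, Real.norm_of_nonneg (hwt _).le, inv_mul_le_iff₀ (hwt _)]
    refine hb.trans (le_of_eq ?_)
    simp only [wt]; ring
  choose T hT using hex
  have hcontr : ContractingWith (1 / 2) T := by
    refine ⟨by rw [← NNReal.coe_lt_coe]; norm_num, LipschitzWith.of_dist_le_mul fun u v => ?_⟩
    rw [BoundedContinuousFunction.dist_le (by positivity)]
    rintro ⟨t, z⟩
    have hz : 0 ≤ ‖z‖ := norm_nonneg _
    have hd : ∀ s, 0 ≤ s → ∀ z, ‖Vof u s z - Vof v s z‖ ≤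
        dist u v * Real.exp (l * s) * (1 + ‖z‖) := by
      intro s hs z
      have : Vof u s z - Vof v s z = wt (s, z) • (u (s, z) - v (s, z)) := by
        simp only [Vof, smul_sub]; abel
      rw [this, norm_smul, Real.norm_of_nonneg (hwt _).le, hwtv s z hs, ← dist_eq_norm]
      have := u.dist_coe_le_dist (g := v) (s, z)
      have h9 : 0 ≤ Real.exp (l * s) * (1 + ‖z‖) := by positivity
      nlinarith
    have hF : ∀ u, IntervalIntegrable (fun s => mfF a B μ (Vof u) s z) volume 0 (max t 0) :=
      fun u => ((mfF_cont a hac B hB C hC μ _ (hVc u)).comp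
        (by fun_prop : Continuous fun s : ℝ => (s, z))).intervalIntegrable _ _
    rw [hT, hT, dist_eq_norm, ← smul_sub, ← intervalIntegral.integral_sub (hF u) (hF v),
      norm_smul, norm_inv, Real.norm_of_nonneg (hwt _).le, inv_mul_le_iff₀ (hwt _)]
    have hb := mf_exp_int l (max t 0) (K * (dist u v * (1 + ‖z‖))) hl0
      (by positivity) (fun s => mfF a B μ (Vof u) s z - mfF a B μ (Vof v) s z)
      (le_max_right _ _) (by
        intro s hs _
        rw [hK]
        exact mfF_lip a La Lb hLa hLb ha B hB C hC h1 h2 μ hμ _ _ (hVc u) (hVc v) l _ hl0.le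
          dist_nonneg hd s hs z)
    refine hb.trans ?_
    have hKl : K / l ≤ 1 / 2 := by rw [div_le_iff₀ hl0]; linarith
    have e : K * (dist u v * (1 + ‖z‖)) / l * Real.exp (l * max t 0)
      = wt (t, z) * (K / l * dist u v) := by simp only [wt]; ring
    rw [e]
    have := (hwt (t, z)).le
    push_cast
    gcongr
  have hfix := hcontr.fixedPoint_isFixedPt
  set u := ContractingWith.fixedPoint T hcontr with hu
  refine ⟨Vof u, hVc u, ?_, ?_⟩
  · intro t ht z
    have h3 : u (t, z) = _ := (congrArg (fun f : X => f (t, z)) hfix.symm).trans (hT u (t, z))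
    rw [max_eq_left ht] at h3
    show z + wt (t, z) • u (t, z) = _
    rw [h3, smul_smul, mul_inv_cancel₀ (hwt _).ne', one_smul]
  · intro V' hV' hmax hsol t ht z
    have hbd : ∀ p : ℝ × E, ‖(wt p)⁻¹ • (V' p.1 p.2 - p.2)‖ ≤ 2 * (1 + ‖a 0‖ + C) + 1 := by
      rintro ⟨t, z⟩
      have hz : 0 ≤ ‖z‖ := norm_nonneg _
      have hap := mf_apriori a La hLa ha B C hC0 hC μ V' hV' l (by linarith) (by linarith) hsol
        (max t 0) (le_max_right _ _) z
      rw [← hmax] at hap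
      rw [norm_smul, norm_inv, Real.norm_of_nonneg (hwt _).le, inv_mul_le_iff₀ (hwt _)]
      have k := norm_sub_le (V' t z) z
      have k5 : 1 ≤ Real.exp (l * max t 0) := Real.one_le_exp (by positivity)
      have k6 : 2 * (‖z‖ + ‖a 0‖ + C) * Real.exp (l * max t 0) ≤
          2 * ((1 + ‖a 0‖ + C) * (1 + ‖z‖)) * Real.exp (l * max t 0) := by
        have : 0 ≤ (‖a 0‖ + C) * ‖z‖ := by positivity
        gcongr
        nlinarith
      have k7 : ‖z‖ ≤ Real.exp (l * max t 0) * (1 + ‖z‖) := by nlinarith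
      simp only [wt]
      calc _ ≤ _ := k
        _ ≤ 2 * ((1 + ‖a 0‖ + C) * (1 + ‖z‖)) * Real.exp (l * max t 0)
            + Real.exp (l * max t 0) * (1 + ‖z‖) := add_le_add (hap.trans k6) k7
        _ = _ := by ring
    let u' : X := BoundedContinuousFunction.ofNormedAddCommGroup
      (fun p : ℝ × E => (wt p)⁻¹ • (V' p.1 p.2 - p.2))
      ((hwtc.inv₀ fun p => (hwt p).ne').smul (hV'.sub continuous_snd)) _ hbd
    have hVV : Vof u' = V' := by
      funext t z
      show z + wt (t, z) • (wt (t, z))⁻¹ • (V' t z - z) = _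
      rw [smul_smul, mul_inv_cancel₀ (hwt _).ne', one_smul, add_sub_cancel]
    have hfix' : Function.IsFixedPt T u' := by
      refine BoundedContinuousFunction.ext fun p => ?_
      rw [hT, hVV]
      show _ = (wt p)⁻¹ • (V' p.1 p.2 - p.2)
      rw [hmax p.1 p.2, hsol _ (le_max_right _ _), add_sub_cancel_left]
    have : u' = u := hcontr.fixedPoint_unique hfix'
    rw [← this, hVV]

end MF

/-- Existence and uniqueness for the retarded mean-field equation with `h(t) = t`:
`Z_t(z) = z + ∫₀ᵗ a(Z_s(z)) ds + ∫₀ᵗ (1/s) ∫₀ˢ Kμ_σ(Z_s(z)) dσ ds`, where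
`Kμ_σ(w) = ∫ B(w, Z_σ(ẑ)) μ₀(dẑ)` (so that `μ_σ = (Z_σ)_# μ₀`), `a` globally Lipschitz
and `B` bounded and Lipschitz in each variable. There is a unique global continuous
solution on `ℝ₊ × ℝᵐ`. -/
theorem stmt_11 (m : ℕ) (La Lb Cb : ℝ) (hLa : 0 ≤ La) (hLb : 0 ≤ Lb)
    (a : EuclideanSpace ℝ (Fin m) → EuclideanSpace ℝ (Fin m))
    (ha : ∀ x y, ‖a x - a y‖ ≤ La * ‖x - y‖)
    (B : EuclideanSpace ℝ (Fin m) → EuclideanSpace ℝ (Fin m) → EuclideanSpace ℝ (Fin m))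
    (hBmeas : Continuous (Function.uncurry B))
    (hBbdd : ∀ z w, ‖B z w‖ ≤ Cb)
    (hBlip1 : ∀ z₁ z₂ w, ‖B z₁ w - B z₂ w‖ ≤ Lb * min 1 ‖z₁ - z₂‖)
    (hBlip2 : ∀ z w₁ w₂, ‖B z w₁ - B z w₂‖ ≤ Lb * min 1 ‖w₁ - w₂‖)
    (μ₀ : Measure (EuclideanSpace ℝ (Fin m))) [IsProbabilityMeasure μ₀]
    (hμ₀ : Integrable (fun z => ‖z‖) μ₀) :
    ∃ Z : ℝ → EuclideanSpace ℝ (Fin m) → EuclideanSpace ℝ (Fin m),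
      (ContinuousOn (fun p : ℝ × EuclideanSpace ℝ (Fin m) => Z p.1 p.2)
          (Set.Ici 0 ×ˢ Set.univ) ∧
        (∀ z, Z 0 z = z) ∧
        (∀ z, ∀ t : ℝ, 0 ≤ t → Z t z = z + (∫ s in (0:ℝ)..t, a (Z s z)) +
          ∫ s in (0:ℝ)..t,
            (1 / s) • ∫ σ in (0:ℝ)..s, ∫ w, B (Z s z) (Z σ w) ∂μ₀)) ∧
      ∀ Z' : ℝ → EuclideanSpace ℝ (Fin m) → EuclideanSpace ℝ (Fin m),
        (ContinuousOn (fun p : ℝ × EuclideanSpace ℝ (Fin m) => Z' p.1 p.2)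
            (Set.Ici 0 ×ˢ Set.univ) ∧
          (∀ z, Z' 0 z = z) ∧
          (∀ z, ∀ t : ℝ, 0 ≤ t → Z' t z = z + (∫ s in (0:ℝ)..t, a (Z' s z)) +
            ∫ s in (0:ℝ)..t,
              (1 / s) • ∫ σ in (0:ℝ)..s, ∫ w, B (Z' s z) (Z' σ w) ∂μ₀)) →
        ∀ z, ∀ t : ℝ, 0 ≤ t → Z' t z = Z t z := by
  have hac : Continuous a := by
    have : LipschitzWith La.toNNReal a := LipschitzWith.of_dist_le_mul fun x y => by
      rw [dist_eq_norm, dist_eq_norm, Real.coe_toNNReal _ hLa]; exact ha x y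
    exact this.continuous
  obtain ⟨V, hV, hsol, huniq⟩ := mf_main a La Lb hLa hLb ha B hBmeas Cb hBbdd hBlip1 hBlip2 μ₀ hμ₀
  refine ⟨V, ⟨hV.continuousOn, fun z => ?_, fun z t ht => ?_⟩, ?_⟩
  · rw [hsol 0 le_rfl z]; simp
  · rw [mf_rhs a hac B hBmeas Cb hBbdd μ₀ V hV V (fun _ _ _ => rfl) z t ht]
    exact hsol t ht z
  · rintro Z' ⟨hc, -, hs⟩ z t ht
    have hV' : Continuous (Function.uncurry fun t z => Z' (max t 0) z) := by
      refine hc.comp_continuous (f := fun p : ℝ × EuclideanSpace ℝ (Fin m) => (max p.1 0, p.2))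
        (by fun_prop) ?_
      intro p
      exact ⟨Set.mem_Ici.2 (le_max_right _ _), Set.mem_univ _⟩
    have hZV : ∀ t, 0 ≤ t → ∀ z, Z' t z = (fun t z => Z' (max t 0) z) t z := by
      intro t ht z; simp only [max_eq_left ht]
    have := huniq _ hV' (fun t z => by simp) (fun t ht z => by
      rw [← mf_rhs a hac B hBmeas Cb hBbdd μ₀ _ hV' Z' hZV z t ht, ← hs z t ht]
      exact (hZV t ht z).symm) t ht z
    rw [← this]
    exact hZV t ht z
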